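/- Let 0 < c1 ≤ c2 be constants and let n range over an increasing sequence of integers along which c1 ≤ f(k0(n)) ≤ c2, and set λ_n = f(k0(n)). Let X_n be the number of independent sets of size k0(n) in G(n,1/2). Then |P(X_n = 0) − e^{−λ_n}| → 0 as n → ∞. -/

import Mathlib

open MeasureTheory ProbabilityTheory Filter Real

namespace RandomBipartiteDecomposition

/-- The set of edges of the complete bipartite graph with vertex classes `A` and `B`. -/
def bicliqueEdges {V : Type*} (A B : Finset V) : Set (Sym2 V) :=
  {e | ∃ a ∈ A, ∃ b ∈ B, e = s(a, b)}

/-- `A`, `B` are the vertex classes of a complete bipartite subgraph of `G`. -/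
def IsBicliqueIn {V : Type*} (G : SimpleGraph V) (A B : Finset V) : Prop :=
  A.Nonempty ∧ B.Nonempty ∧ Disjoint A B ∧ ∀ a ∈ A, ∀ b ∈ B, G.Adj a b

/-- A complete bipartite subgraph is nontrivial if both classes have at least 2 vertices. -/
def IsNontrivialBicliqueIn {V : Type*} (G : SimpleGraph V) (A B : Finset V) : Prop :=
  2 ≤ A.card ∧ 2 ≤ B.card ∧ Disjoint A B ∧ ∀ a ∈ A, ∀ b ∈ B, G.Adj a b

/-- `P` lists `m` pairwise edge-disjoint complete bipartite subgraphs of `G` such that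
every edge of `G` belongs to exactly one of them. -/
def IsBicliqueDecomp {V : Type*} (G : SimpleGraph V) (m : ℕ)
    (P : Fin m → Finset V × Finset V) : Prop :=
  (∀ i, IsBicliqueIn G (P i).1 (P i).2) ∧
  (∀ i j, i ≠ j →
    Disjoint (bicliqueEdges (P i).1 (P i).2) (bicliqueEdges (P j).1 (P j).2)) ∧
  (⋃ i, bicliqueEdges (P i).1 (P i).2) = G.edgeSet

/-- As above but with all complete bipartite subgraphs nontrivial. -/
def IsNontrivialBicliqueDecomp {V : Type*} (G : SimpleGraph V) (m : ℕ)
    (P : Fin m → Finset V × Finset V) : Prop :=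
  (∀ i, IsNontrivialBicliqueIn G (P i).1 (P i).2) ∧
  (∀ i j, i ≠ j →
    Disjoint (bicliqueEdges (P i).1 (P i).2) (bicliqueEdges (P j).1 (P j).2)) ∧
  (⋃ i, bicliqueEdges (P i).1 (P i).2) = G.edgeSet

/-- `τ(G)`: the minimum number of pairwise edge-disjoint complete bipartite subgraphs
of `G` so that each edge of `G` belongs to exactly one of them. -/
noncomputable def tau {V : Type*} (G : SimpleGraph V) : ℕ :=
  sInf {m | ∃ P : Fin m → Finset V × Finset V, IsBicliqueDecomp G m P}

/-- `τ'(G)`: the minimum number of pairwise edge-disjoint *nontrivial* complete bipartite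
subgraphs of `G` covering all edges of `G`; `⊤` if there is no such cover. -/
noncomputable def tau' {V : Type*} (G : SimpleGraph V) : ℕ∞ :=
  sInf {t : ℕ∞ | ∃ m : ℕ, t = m ∧ ∃ P : Fin m → Finset V × Finset V,
    IsNontrivialBicliqueDecomp G m P}

/-- `S` is an independent set of `G`. -/
def IsIndepFinset {V : Type*} (G : SimpleGraph V) (S : Finset V) : Prop :=
  ∀ a ∈ S, ∀ b ∈ S, ¬ G.Adj a b

/-- `α(G)`: the maximum size of an independent set of `G`. -/
noncomputable def alpha {V : Type*} (G : SimpleGraph V) : ℕ :=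
  sSup {k | ∃ S : Finset V, S.card = k ∧ IsIndepFinset G S}

/-- `S` induces in `G` a complete bipartite graph with nonempty vertex classes `A`, `B`. -/
def IsInducedCompleteBipartite {V : Type*} (G : SimpleGraph V) (S A B : Finset V) : Prop :=
  A.Nonempty ∧ B.Nonempty ∧ Disjoint A B ∧ (A : Set V) ∪ (B : Set V) = (S : Set V) ∧
  ∀ u ∈ S, ∀ v ∈ S, (G.Adj u v ↔ ((u ∈ A ∧ v ∈ B) ∨ (u ∈ B ∧ v ∈ A)))

/-- `β(G)`: the largest number of vertices of an induced complete bipartite subgraph. -/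
noncomputable def beta {V : Type*} (G : SimpleGraph V) : ℕ :=
  sSup {k | ∃ S A B : Finset V, IsInducedCompleteBipartite G S A B ∧ S.card = k}

/-- The Bernoulli measure on `Bool` giving `true` probability `p`. -/
noncomputable def bernoulliBool (p : ℝ) : Measure Bool :=
  p.toNNReal • Measure.dirac true + (1 - p).toNNReal • Measure.dirac false

instance (p : ℝ) : IsFiniteMeasure (bernoulliBool p) := by
  unfold bernoulliBool; infer_instance

/-- The Erdős–Rényi random graph `G(n,p)`: each unordered pair of vertices flips an
independent `p`-coin. Events about the graph are subsets of the coin-flip space. -/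
noncomputable def erdosRenyi (n : ℕ) (p : ℝ) : Measure (Sym2 (Fin n) → Bool) :=
  Measure.pi fun _ => bernoulliBool p

/-- The simple graph determined by the coin flips `ω`. -/
def graphOf (n : ℕ) (ω : Sym2 (Fin n) → Bool) : SimpleGraph (Fin n) :=
  SimpleGraph.fromEdgeSet {e | ω e = true}

/-- `f(k) = C(n,k) · 2^{-C(k,2)}`, the expected number of independent sets of size `k`
in `G(n,1/2)`. -/
noncomputable def f (n k : ℕ) : ℝ :=
  (n.choose k : ℝ) * (2 : ℝ) ^ (-(k.choose 2 : ℤ))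

/-- `k₀(n)`: the largest `k` with `f(k) ≥ 1`. -/
noncomputable def k0 (n : ℕ) : ℕ := sSup {k | 1 ≤ f n k}

/-- `g(k) = C(n,k+2) · (2^{k+1} - 1) · 2^{-C(k+2,2)}`, the expected number of induced
complete bipartite subgraphs on `k+2` vertices in `G(n,1/2)`. -/
noncomputable def g (n k : ℕ) : ℝ :=
  (n.choose (k + 2) : ℝ) * ((2 : ℝ) ^ (k + 1) - 1) * (2 : ℝ) ^ (-((k + 2).choose 2 : ℤ))

/-- The number of independent sets of size `k` in the graph determined by `ω`. -/
noncomputable def numIndep (n k : ℕ) (ω : Sym2 (Fin n) → Bool) : ℕ :=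
  Set.ncard {S : Finset (Fin n) | S.card = k ∧ IsIndepFinset (graphOf n ω) S}

/-- The number of `m`-element vertex subsets inducing a complete bipartite graph in the
graph determined by `ω`. -/
noncomputable def numBip (n m : ℕ) (ω : Sym2 (Fin n) → Bool) : ℕ :=
  Set.ncard {S : Finset (Fin n) | S.card = m ∧
    ∃ A B : Finset (Fin n), IsInducedCompleteBipartite (graphOf n ω) S A B}

/-- Poisson approximation for the void probability of a family of dissociated events: if each
event `E a` is independent of the number of events outside its neighbourhood `R a`, then the
probability that no event occurs is close to `exp (-λ)`. -/
lemma abs_void_sub_exp_le {Ω ι : Type*} [Fintype Ω] [DecidableEq Ω] [DecidableEq ι]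
    (m : Ω → ℝ) (hm0 : ∀ ω, 0 ≤ m ω)
    (hm1 : ∑ ω, m ω = 1) (A : Finset ι) (E : ι → Finset Ω) (R : ι → ι → Prop)
    [DecidableRel R] (hR : ∀ a ∈ A, R a a)
    (hind : ∀ a ∈ A, ∀ z : ℝ,
      ∑ ω ∈ E a, m ω * z ^ ({b ∈ A | ¬ R a b ∧ ω ∈ E b} : Finset ι).card =
        (∑ ω ∈ E a, m ω) * ∑ ω, m ω * z ^ ({b ∈ A | ¬ R a b ∧ ω ∈ E b} : Finset ι).card) :
    |∑ ω with ∀ a ∈ A, ω ∉ E a, m ω - exp (-∑ a ∈ A, ∑ ω ∈ E a, m ω)| ≤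
      ∑ a ∈ A, ((∑ ω ∈ E a, m ω) * ∑ b ∈ A with R a b, ∑ ω ∈ E b, m ω +
        ∑ b ∈ A with R a b ∧ b ≠ a, ∑ ω ∈ E a ∩ E b, m ω) := by
  set X : Ω → ℕ := fun ω => ({b ∈ A | ω ∈ E b} : Finset ι).card with hX
  set W : ι → Ω → ℕ := fun a ω => ({b ∈ A | ¬ R a b ∧ ω ∈ E b} : Finset ι).card with hW
  set Y : ι → Ω → ℕ := fun a ω => ({b ∈ A | R a b ∧ ω ∈ E b} : Finset ι).card with hY
  set Y' : ι → Ω → ℕ := fun a ω => ({b ∈ A | (R a b ∧ b ≠ a) ∧ ω ∈ E b} : Finset ι).card with hY'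
  set p : ι → ℝ := fun a => ∑ ω ∈ E a, m ω with hp
  have hXWY : ∀ a ω, X ω = W a ω + Y a ω := by
    intro a ω
    simp only [hX, hW, hY]
    rw [← Finset.card_union_of_disjoint]
    · congr 1
      ext b
      simp only [Finset.mem_filter, Finset.mem_union]
      tauto
    · rw [Finset.disjoint_left]
      simp only [Finset.mem_filter]
      tauto
  have hYY' : ∀ a ∈ A, ∀ ω ∈ E a, Y a ω = Y' a ω + 1 := by
    intro a ha ω hω
    simp only [hY, hY']
    rw [← Finset.card_insert_of_notMem (a := a)]
    · congr 1
      ext b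
      simp only [Finset.mem_filter, Finset.mem_insert]
      constructor
      · tauto
      · rintro (rfl | h)
        · exact ⟨ha, hR _ ha, hω⟩
        · tauto
    · simp
  have sumY : ∀ a, ∑ ω, m ω * (Y a ω : ℝ) = ∑ b ∈ A with R a b, p b := by
    intro a
    simp only [hY, hp, Finset.card_filter, Nat.cast_sum, Finset.mul_sum, Finset.sum_filter]
    rw [Finset.sum_comm]
    refine Finset.sum_congr rfl fun b _ => ?_
    by_cases h : R a b
    · simp [h]
    · simp [h]
  have sumY' : ∀ a, ∑ ω ∈ E a, m ω * (Y' a ω : ℝ) =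
      ∑ b ∈ A with R a b ∧ b ≠ a, ∑ ω ∈ E a ∩ E b, m ω := by
    intro a
    simp only [hY', Finset.card_filter, Nat.cast_sum, Finset.mul_sum]
    rw [Finset.sum_comm, Finset.sum_filter]
    refine Finset.sum_congr rfl fun b _ => ?_
    by_cases h : R a b ∧ b ≠ a
    · simp [h, Finset.sum_ite_mem]
    · simp [h]
  have sumX : ∀ u : Ω → ℝ, ∑ ω, m ω * (X ω * u ω) = ∑ a ∈ A, ∑ ω ∈ E a, m ω * u ω := by
    intro u
    simp only [hX, Finset.card_filter, Nat.cast_sum, Finset.sum_mul, Finset.mul_sum]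
    rw [Finset.sum_comm]
    refine Finset.sum_congr rfl fun b _ => ?_
    simp
  have pow_sub : ∀ z ∈ Set.Icc (0 : ℝ) 1, ∀ i j : ℕ, |z ^ (i + j) - z ^ i| ≤ j := by
    intro z hz i j
    have h1 : z ^ (i + j) ≤ z ^ i := pow_le_pow_of_le_one hz.1 hz.2 (by omega)
    rw [abs_sub_comm, abs_of_nonneg (by linarith)]
    have h2 : z ^ i * (1 - z ^ j) ≤ 1 * (1 - z ^ j) := by
      have := pow_le_one₀ hz.1 hz.2 (n := i)
      have := pow_le_one₀ hz.1 hz.2 (n := j)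
      gcongr
    rcases Nat.eq_zero_or_pos j with rfl | hj
    · simp
    · have : (1 : ℝ) ≤ j := by exact_mod_cast hj
      have : 0 ≤ z ^ j := pow_nonneg hz.1 _
      rw [pow_add]
      linarith
  set l := ∑ a ∈ A, p a with hl
  set ε := ∑ a ∈ A, (p a * ∑ b ∈ A with R a b, p b +
        ∑ b ∈ A with R a b ∧ b ≠ a, ∑ ω ∈ E a ∩ E b, m ω) with hε
  have p0 : ∀ a, 0 ≤ p a := fun a => Finset.sum_nonneg fun _ _ => hm0 _
  set φ : ℝ → ℝ := fun z => ∑ ω, m ω * z ^ X ω with hφ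
  set φ' : ℝ → ℝ := fun z => ∑ ω, m ω * (X ω * z ^ (X ω - 1)) with hφ'
  have key : ∀ z ∈ Set.Icc (0 : ℝ) 1, |φ' z - l * φ z| ≤ ε := by
    intro z hz
    have : φ' z - l * φ z = ∑ a ∈ A, (∑ ω ∈ E a, m ω * (z ^ (X ω - 1) - z ^ W a ω) +
        p a * ∑ ω, m ω * (z ^ W a ω - z ^ X ω)) := by
      simp only [hφ', sumX, hl, Finset.sum_mul]
      rw [← Finset.sum_sub_distrib]
      refine Finset.sum_congr rfl fun a ha => ?_
      simp only [mul_sub, Finset.sum_sub_distrib]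
      rw [hind a ha z]
      ring
    rw [this, hε]
    refine (Finset.abs_sum_le_sum_abs _ _).trans (Finset.sum_le_sum fun a ha => ?_)
    rw [add_comm (p a * _)]
    refine (abs_add_le _ _).trans (add_le_add ?_ ?_)
    · rw [← sumY' a]
      refine (Finset.abs_sum_le_sum_abs _ _).trans (Finset.sum_le_sum fun ω hω => ?_)
      rw [abs_mul, abs_of_nonneg (hm0 ω)]
      refine mul_le_mul_of_nonneg_left ?_ (hm0 ω)
      have : X ω - 1 = W a ω + Y' a ω := by
        have := hXWY a ω
        have := hYY' a ha ω hω
        omega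
      rw [this]
      exact pow_sub z hz _ _
    · rw [abs_mul, abs_of_nonneg (p0 a)]
      refine mul_le_mul_of_nonneg_left ?_ (p0 a)
      rw [← sumY a]
      refine (Finset.abs_sum_le_sum_abs _ _).trans (Finset.sum_le_sum fun ω hω => ?_)
      rw [abs_mul, abs_of_nonneg (hm0 ω)]
      refine mul_le_mul_of_nonneg_left ?_ (hm0 ω)
      rw [hXWY a ω, abs_sub_comm]
      exact pow_sub z hz _ _
  have hderiv : ∀ z, HasDerivAt φ (φ' z) z := by
    intro z
    refine HasDerivAt.fun_sum fun ω _ => ?_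
    exact (hasDerivAt_pow (X ω) z).const_mul (m ω)
  have l0 : 0 ≤ l := Finset.sum_nonneg fun a _ => p0 a
  have hderiv2 : ∀ z, HasDerivAt (fun z => exp (-(l * z)) * φ z)
      (exp (-(l * z)) * (φ' z - l * φ z)) z := by
    intro z
    have h1 : HasDerivAt (fun z : ℝ => -(l * z)) (-l) z := by
      simpa using ((hasDerivAt_id z).const_mul l).fun_neg
    refine (h1.exp.fun_mul (hderiv z)).congr_deriv ?_
    ring
  have := norm_image_sub_le_of_norm_deriv_le_segment_01' (f := fun z => exp (-(l * z)) * φ z)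
    (f' := fun z => exp (-(l * z)) * (φ' z - l * φ z)) (C := ε)
    (fun z _ => (hderiv2 z).hasDerivWithinAt) (by
      intro z hz
      have hz' : z ∈ Set.Icc (0 : ℝ) 1 := ⟨hz.1, hz.2.le⟩
      rw [norm_mul, Real.norm_eq_abs, Real.norm_eq_abs, abs_of_pos (exp_pos _)]
      have h1 : exp (-(l * z)) ≤ 1 := by
        rw [exp_le_one_iff]
        have := mul_nonneg l0 hz.1
        linarith
      calc _ ≤ 1 * |φ' z - l * φ z| := by gcongr
        _ ≤ ε := by rw [one_mul]; exact key z hz')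
  have hφ1 : φ 1 = 1 := by simp [hφ, hm1]
  have hφ0 : φ 0 = ∑ ω with ∀ a ∈ A, ω ∉ E a, m ω := by
    simp only [hφ, Finset.sum_filter]
    refine Finset.sum_congr rfl fun ω _ => ?_
    by_cases h : ∀ a ∈ A, ω ∉ E a
    · have : X ω = 0 := by simpa [hX, Finset.filter_eq_empty_iff] using h
      rw [this, if_pos h]
      simp
    · have : X ω ≠ 0 := by simpa [hX, Finset.filter_eq_empty_iff] using h
      rw [if_neg h, zero_pow this, mul_zero]
  simp only [hφ1, hφ0, mul_one, mul_zero, neg_zero, exp_zero, one_mul, Real.norm_eq_abs] at this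
  rwa [abs_sub_comm]

section CoinFlips

open Finset

variable {ι : Type*} [Fintype ι] [DecidableEq ι]

/-- Functions of disjoint sets of coin flips are independent. -/
lemma sum_mul_eq_of_dependsOn (F : Finset ι) (u v : (ι → Bool) → ℝ)
    (hu : DependsOn u (F : Set ι)) (hv : DependsOn v (F : Set ι)ᶜ) :
    (∑ ω, (1 / 2 : ℝ) ^ Fintype.card ι * (u ω * v ω)) =
      (∑ ω, (1 / 2 : ℝ) ^ Fintype.card ι * u ω) * ∑ ω, (1 / 2 : ℝ) ^ Fintype.card ι * v ω := by
  let e := (Equiv.piEquivPiSubtypeProd (· ∈ F) (fun _ => Bool)).symm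
  have hU : ∀ x, u (e x) = u (e (x.1, fun _ => false)) := by
    intro x
    refine hu fun i hi => ?_
    have hi' : i ∈ F := hi
    simp [e, hi']
  have hV : ∀ x, v (e x) = v (e (fun _ => false, x.2)) := by
    intro x
    refine hv fun i hi => ?_
    have hi' : i ∉ F := hi
    simp [e, hi']
  have hcard : (1 / 2 : ℝ) ^ Fintype.card ι *
      ((Fintype.card ({i // i ∈ F} → Bool) : ℝ) * Fintype.card ({i // i ∉ F} → Bool)) = 1 := by
    rw [← Nat.cast_mul, ← Fintype.card_prod, ← Fintype.card_congr e.symm]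
    simp
  simp only [← mul_sum]
  rw [← e.sum_comp, ← e.sum_comp u, ← e.sum_comp v]
  simp_rw [hU, hV]
  simp only [Fintype.sum_prod_type, sum_const, card_univ, nsmul_eq_mul, ← mul_sum, ← sum_mul]
  linear_combination (-(1 / 2 : ℝ) ^ Fintype.card ι * (∑ a, u (e (a, fun _ => false))) *
    (∑ b, v (e (fun _ => false, b)))) * hcard

/-- The probability that all the coin flips in `F` are `false`. -/
lemma sum_forall_eq_false (F : Finset ι) :
    ∑ ω : ι → Bool with ∀ e ∈ F, ω e = false, (1 / 2 : ℝ) ^ Fintype.card ι =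
      (1 / 2 : ℝ) ^ F.card := by
  have h := prod_univ_sum (fun _ : ι => (univ : Finset Bool))
    (fun e b => if e ∈ F ∧ b = true then (0 : ℝ) else 1 / 2)
  rw [Fintype.piFinset_univ] at h
  rw [sum_filter]
  trans ∑ ω : ι → Bool, ∏ e, if e ∈ F ∧ ω e = true then (0 : ℝ) else 1 / 2
  · refine sum_congr rfl fun ω _ => ?_
    split_ifs with hω
    · rw [prod_congr rfl (g := fun _ => (1 / 2 : ℝ))]
      · simp
      · intro e _
        rw [if_neg]
        rintro ⟨he, h1⟩
        simp [hω e he] at h1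
    · push Not at hω
      obtain ⟨e, he, h1⟩ := hω
      symm
      refine prod_eq_zero (mem_univ e) (if_pos ⟨he, by simpa using h1⟩)
  · rw [← h]
    have : ∀ e : ι, (∑ b : Bool, if e ∈ F ∧ b = true then (0 : ℝ) else 1 / 2) =
        if e ∈ F then 1 / 2 else 1 := by
      intro e
      by_cases he : e ∈ F <;> simp [he]
    simp_rw [this]
    rw [prod_ite]
    simp

end CoinFlips

section Edges

open Finset

variable {V : Type*} [DecidableEq V]

/-- The pairs of distinct elements of `S`. -/
def pairsOf (S : Finset V) : Finset (Sym2 V) := {e ∈ S.sym2 | ¬ e.IsDiag}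

lemma mk_mem_pairsOf {S : Finset V} {a b : V} : s(a, b) ∈ pairsOf S ↔ a ∈ S ∧ b ∈ S ∧ a ≠ b := by
  simp [pairsOf, and_assoc]

lemma pairsOf_inter (S T : Finset V) : pairsOf S ∩ pairsOf T = pairsOf (S ∩ T) := by
  ext e
  induction e with
  | h a b =>
    simp only [mem_inter, mk_mem_pairsOf]
    tauto

lemma card_pairsOf (S : Finset V) : (pairsOf S).card = S.card.choose 2 := by
  rw [← Sym2.card_image_offDiag]
  congr 1
  ext e
  induction e with
  | h a b =>
    simp only [mk_mem_pairsOf, mem_image, mem_offDiag, Prod.exists, Function.uncurry, Sym2.eq_iff]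
    constructor
    · intro h
      exact ⟨a, b, h, Or.inl ⟨rfl, rfl⟩⟩
    · rintro ⟨x, y, h, ⟨rfl, rfl⟩ | ⟨rfl, rfl⟩⟩
      · exact h
      · exact ⟨h.2.1, h.1, h.2.2.symm⟩

lemma card_pairsOf_union (S T : Finset V) :
    (pairsOf S ∪ pairsOf T).card + (S ∩ T).card.choose 2 =
      S.card.choose 2 + T.card.choose 2 := by
  rw [← card_pairsOf (S ∩ T), ← pairsOf_inter, card_union_add_card_inter, card_pairsOf,
    card_pairsOf]

lemma disjoint_pairsOf {S T : Finset V} (h : ¬ 2 ≤ (S ∩ T).card) :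
    Disjoint (pairsOf S) (pairsOf T) := by
  rw [disjoint_iff_inter_eq_empty, pairsOf_inter, ← card_eq_zero, card_pairsOf,
    Nat.choose_eq_zero_of_lt (by omega)]

end Edges

lemma isIndepFinset_graphOf_iff {n : ℕ} {ω : Sym2 (Fin n) → Bool} {S : Finset (Fin n)} :
    IsIndepFinset (graphOf n ω) S ↔ ∀ e ∈ pairsOf S, ω e = false := by
  constructor
  · intro h e
    induction e with
    | h a b =>
      intro he
      rw [mk_mem_pairsOf] at he
      have := h a he.1 b he.2.1
      simpa [graphOf, he.2.2] using this
  · intro h a ha b hb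
    simp only [graphOf, SimpleGraph.fromEdgeSet_adj, Set.mem_ofPred_eq, not_and, not_not]
    intro h1
    by_contra hab
    simp [h _ (mk_mem_pairsOf.2 ⟨ha, hb, hab⟩)] at h1

lemma erdosRenyi_half_toReal (n : ℕ) (Q : (Sym2 (Fin n) → Bool) → Prop) [DecidablePred Q] :
    (erdosRenyi n (1 / 2) {ω | Q ω}).toReal =
      ∑ ω with Q ω, (1 / 2 : ℝ) ^ Fintype.card (Sym2 (Fin n)) := by
  have hb : ∀ b, bernoulliBool (1 / 2) {b} = ENNReal.ofReal (1 / 2) := by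
    intro b
    have h2 : (1 - 1 / 2 : ℝ) = 1 / 2 := by norm_num
    rw [bernoulliBool, h2]
    simp only [Measure.add_apply, Measure.coe_nnreal_smul_apply]
    cases b <;> simp [ENNReal.ofReal, -one_div]
  have : IsFiniteMeasure (erdosRenyi n (1 / 2)) := by
    unfold erdosRenyi
    infer_instance
  have h := sum_measureReal_singleton (μ := erdosRenyi n (1 / 2))
    (Finset.univ.filter Q)
  rw [Finset.coe_filter_univ] at h
  change (erdosRenyi n (1 / 2)).real {ω | Q ω} = _
  rw [← h]
  refine Finset.sum_congr rfl fun ω _ => ?_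
  rw [measureReal_def, erdosRenyi, Measure.pi_singleton]
  simp only [hb, Finset.prod_const, Finset.card_univ, ENNReal.toReal_pow]
  rw [ENNReal.toReal_ofReal (by norm_num)]

section Counting

open Finset

lemma card_filter_card_inter_mul_choose_le {n k i : ℕ} (S : Finset (Fin n)) (hS : S.card = k)
    (hik : i ≤ k) :
    ({T ∈ powersetCard k (univ : Finset (Fin n)) | (S ∩ T).card = i} : Finset _).card *
      n.choose i ≤ k.choose i ^ 2 * n.choose k := by
  have h1 : ({T ∈ powersetCard k (univ : Finset (Fin n)) | (S ∩ T).card = i} : Finset _) ⊆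
      (powersetCard i S).biUnion fun U => (powersetCard (k - i) Uᶜ).image (U ∪ ·) := by
    intro T hT
    simp only [mem_filter, mem_powersetCard, subset_univ, true_and] at hT
    simp only [mem_biUnion, mem_powersetCard, mem_image]
    refine ⟨S ∩ T, ⟨inter_subset_left, hT.2⟩, T \ (S ∩ T), ⟨?_, ?_⟩, ?_⟩
    · exact fun x hx => mem_compl.2 (mem_sdiff.1 hx).2
    · rw [card_sdiff_of_subset inter_subset_right, hT.1, hT.2]
    · exact union_sdiff_of_subset inter_subset_right
  have h2 : ({T ∈ powersetCard k (univ : Finset (Fin n)) | (S ∩ T).card = i} : Finset _).card ≤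
      k.choose i * (n - i).choose (k - i) := by
    refine (card_le_card h1).trans ((card_biUnion_le_card_mul _ _
      ((n - i).choose (k - i)) fun U hU => ?_).trans_eq ?_)
    · refine card_image_le.trans_eq ?_
      rw [card_powersetCard, card_compl, (mem_powersetCard.1 hU).2, Fintype.card_fin]
    · rw [card_powersetCard, hS]
  calc _ ≤ k.choose i * (n - i).choose (k - i) * n.choose i := Nat.mul_le_mul_right _ h2
    _ = k.choose i * (n.choose i * (n - i).choose (k - i)) := by ring
    _ = k.choose i ^ 2 * n.choose k := by rw [← Nat.choose_mul hik]; ring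

end Counting

lemma f_eq (n k : ℕ) : f n k = n.choose k * (1 / 2 : ℝ) ^ k.choose 2 := by
  rw [f, zpow_neg, zpow_natCast, one_div, inv_pow]

lemma f_nonneg (n k : ℕ) : 0 ≤ f n k := by
  rw [f_eq]
  positivity

section Overlap

open Finset

lemma sum_overlap_le {n k : ℕ} (hkn : k ≤ n) {δ : ℝ} (hδ0 : 0 ≤ δ)
    (hδ : ∀ i ∈ Ico 2 k, (k.choose i : ℝ) ^ 2 / f n i ≤ δ)
    (S : Finset (Fin n)) (hS : S.card = k) :
    ∑ T ∈ powersetCard k (univ : Finset (Fin n)) with 2 ≤ (S ∩ T).card ∧ T ≠ S,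
      (1 / 2 : ℝ) ^ (pairsOf S ∪ pairsOf T).card ≤
      (1 / 2 : ℝ) ^ k.choose 2 * f n k * (k * δ) := by
  have hmaps : ∀ T ∈ ({T ∈ powersetCard k (univ : Finset (Fin n)) | 2 ≤ (S ∩ T).card ∧ T ≠ S} :
      Finset _), (S ∩ T).card ∈ Ico 2 k := by
    intro T hT
    simp only [mem_filter, mem_powersetCard, subset_univ, true_and] at hT
    refine mem_Ico.2 ⟨hT.2.1, lt_of_not_ge fun h => hT.2.2 ?_⟩
    have h1 : S ∩ T = S := eq_of_subset_of_card_le inter_subset_left (by omega)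
    have h2 : S ∩ T = T := eq_of_subset_of_card_le inter_subset_right (by omega)
    rw [← h2, h1]
  rw [← sum_fiberwise_of_maps_to hmaps]
  have hterm : ∀ i ∈ Ico 2 k, ∑ T ∈ ({T ∈ powersetCard k (univ : Finset (Fin n)) |
      2 ≤ (S ∩ T).card ∧ T ≠ S} : Finset _) with (S ∩ T).card = i,
        (1 / 2 : ℝ) ^ (pairsOf S ∪ pairsOf T).card ≤
      (1 / 2 : ℝ) ^ k.choose 2 * f n k * δ := by
    intro i hi
    have hik : i ≤ k := (mem_Ico.1 hi).2.le
    have hle : i.choose 2 ≤ k.choose 2 := Nat.choose_le_choose 2 hik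
    have hpos : (0 : ℝ) < n.choose i := by exact_mod_cast Nat.choose_pos (hik.trans hkn)
    have hval : ∀ T ∈ ({T ∈ powersetCard k (univ : Finset (Fin n)) | (S ∩ T).card = i} :
        Finset _), (1 / 2 : ℝ) ^ (pairsOf S ∪ pairsOf T).card =
          (1 / 2 : ℝ) ^ k.choose 2 * (1 / 2 : ℝ) ^ k.choose 2 * 2 ^ i.choose 2 := by
      intro T hT
      simp only [mem_filter, mem_powersetCard, subset_univ, true_and] at hT
      have h := card_pairsOf_union S T
      rw [hT.1, hS, hT.2] at h
      rw [← pow_add, ← h, pow_add, mul_assoc, ← mul_pow]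
      norm_num
    calc _ ≤ ∑ T ∈ ({T ∈ powersetCard k (univ : Finset (Fin n)) | (S ∩ T).card = i} : Finset _),
          (1 / 2 : ℝ) ^ (pairsOf S ∪ pairsOf T).card := by
          refine sum_le_sum_of_subset_of_nonneg ?_ fun _ _ _ => by positivity
          intro T hT
          simp only [mem_filter] at hT ⊢
          exact ⟨hT.1.1, hT.2⟩
      _ = ({T ∈ powersetCard k (univ : Finset (Fin n)) | (S ∩ T).card = i} : Finset _).card *
          ((1 / 2 : ℝ) ^ k.choose 2 * (1 / 2 : ℝ) ^ k.choose 2 * 2 ^ i.choose 2) := by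
          rw [sum_congr rfl hval, sum_const, nsmul_eq_mul]
      _ ≤ ((k.choose i : ℝ) ^ 2 * n.choose k / n.choose i) *
          ((1 / 2 : ℝ) ^ k.choose 2 * (1 / 2 : ℝ) ^ k.choose 2 * 2 ^ i.choose 2) := by
          refine mul_le_mul_of_nonneg_right ?_ (by positivity)
          rw [le_div_iff₀ hpos]
          exact_mod_cast card_filter_card_inter_mul_choose_le S hS hik
      _ = (1 / 2 : ℝ) ^ k.choose 2 * f n k * ((k.choose i : ℝ) ^ 2 / f n i) := by
          rw [f_eq, f_eq]
          simp only [one_div, inv_pow]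
          field_simp
      _ ≤ _ := mul_le_mul_of_nonneg_left (hδ i hi) (mul_nonneg (by positivity) (f_nonneg _ _))
  refine (sum_le_sum hterm).trans ?_
  rw [sum_const, nsmul_eq_mul, Nat.card_Ico]
  have : ((k - 2 : ℕ) : ℝ) ≤ k := by exact_mod_cast Nat.sub_le k 2
  have h0 : 0 ≤ (1 / 2 : ℝ) ^ k.choose 2 * f n k * δ :=
    mul_nonneg (mul_nonneg (by positivity) (f_nonneg _ _)) hδ0
  calc _ ≤ (k : ℝ) * ((1 / 2 : ℝ) ^ k.choose 2 * f n k * δ) := by gcongr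
    _ = _ := by ring

lemma abs_void_indep_sub_exp_le {n k : ℕ} (hkn : k ≤ n) (hk : 2 ≤ k) {δ : ℝ} (hδ0 : 0 ≤ δ)
    (hδ : ∀ i ∈ Ico 2 k, (k.choose i : ℝ) ^ 2 / f n i ≤ δ) :
    |(erdosRenyi n (1/2) {ω | numIndep n k ω = 0}).toReal - Real.exp (-(f n k))| ≤
      f n k * (1 / 2) ^ k.choose 2 + 2 * (f n k ^ 2 * (k * δ)) := by
  set N := Fintype.card (Sym2 (Fin n)) with hN
  set A := powersetCard k (univ : Finset (Fin n)) with hA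
  set E : Finset (Fin n) → Finset (Sym2 (Fin n) → Bool) :=
    fun S => {ω | ∀ e ∈ pairsOf S, ω e = false} with hE
  have hm1 : ∑ ω : Sym2 (Fin n) → Bool, (1 / 2 : ℝ) ^ N = 1 := by simp [hN]
  have hEF : ∀ S, ∑ ω ∈ E S, (1 / 2 : ℝ) ^ N = (1 / 2 : ℝ) ^ (pairsOf S).card := fun S =>
    sum_forall_eq_false (pairsOf S)
  have hEA : ∀ S ∈ A, ∑ ω ∈ E S, (1 / 2 : ℝ) ^ N = (1 / 2 : ℝ) ^ k.choose 2 := by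
    intro S hS
    rw [hEF, card_pairsOf, (mem_powersetCard.1 hS).2]
  have hEE : ∀ S T, ∑ ω ∈ E S ∩ E T, (1 / 2 : ℝ) ^ N =
      (1 / 2 : ℝ) ^ (pairsOf S ∪ pairsOf T).card := by
    intro S T
    rw [← sum_forall_eq_false]
    refine sum_congr ?_ fun _ _ => rfl
    ext ω
    simp only [hE, mem_inter, mem_filter, mem_univ, true_and, mem_union]
    constructor
    · rintro ⟨h1, h2⟩ e (he | he)
      exacts [h1 e he, h2 e he]
    · exact fun h => ⟨fun e he => h e (Or.inl he), fun e he => h e (Or.inr he)⟩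
  have hsum : ∑ S ∈ A, ∑ ω ∈ E S, (1 / 2 : ℝ) ^ N = f n k := by
    rw [sum_congr rfl hEA, sum_const, nsmul_eq_mul, hA, card_powersetCard, card_univ,
      Fintype.card_fin, f_eq]
  have hvoid : (erdosRenyi n (1/2) {ω | numIndep n k ω = 0}).toReal =
      ∑ ω with ∀ S ∈ A, ω ∉ E S, (1 / 2 : ℝ) ^ N := by
    rw [erdosRenyi_half_toReal]
    refine sum_congr ?_ fun _ _ => rfl
    ext ω
    rw [mem_filter, mem_filter, numIndep, Set.ncard_eq_zero, Set.eq_empty_iff_forall_notMem]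
    simp [hE, hA, isIndepFinset_graphOf_iff]
  have hmain := abs_void_sub_exp_le (fun _ : Sym2 (Fin n) → Bool => (1 / 2 : ℝ) ^ N)
    (fun _ => by positivity) hm1 A E (fun S T => 2 ≤ (S ∩ T).card)
    (fun S hS => by rw [inter_self, (mem_powersetCard.1 hS).2]; exact hk) (by
      intro S hS z
      have h := sum_mul_eq_of_dependsOn (pairsOf S)
        (fun ω => if ω ∈ E S then (1 : ℝ) else 0)
        (fun ω => z ^ ({T ∈ A | ¬ 2 ≤ (S ∩ T).card ∧ ω ∈ E T} : Finset _).card)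
        (by
          intro ω ω' hω
          have : ω ∈ E S ↔ ω' ∈ E S := by
            simp only [hE, mem_filter, mem_univ, true_and]
            refine forall₂_congr fun e he => ?_
            rw [hω e he]
          simp only [this])
        (by
          intro ω ω' hω
          dsimp only
          congr 2
          refine filter_congr fun T _ => and_congr_right fun hST => ?_
          simp only [hE, mem_filter, mem_univ, true_and]
          refine forall₂_congr fun e he => ?_
          rw [hω e fun he' => Finset.disjoint_left.1 (disjoint_pairsOf hST) he' he])
      simpa only [ite_mul, one_mul, zero_mul, mul_ite, mul_one, mul_zero, sum_ite_mem,
        univ_inter] using h)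
  rw [hsum] at hmain
  rw [hvoid]
  refine (le_of_eq (by congr!)).trans (hmain.trans ?_)
  set p : ℝ := (1 / 2 : ℝ) ^ k.choose 2 with hp
  have hp0 : 0 ≤ p := by positivity
  have hterm : ∀ S ∈ A, (∑ ω ∈ E S, (1 / 2 : ℝ) ^ N) *
      (∑ T ∈ A with 2 ≤ (S ∩ T).card, ∑ ω ∈ E T, (1 / 2 : ℝ) ^ N) +
      ∑ T ∈ A with 2 ≤ (S ∩ T).card ∧ T ≠ S, ∑ ω ∈ E S ∩ E T, (1 / 2 : ℝ) ^ N ≤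
      p * p + 2 * (p * f n k * (k * δ)) := by
    intro S hS
    have hSk := (mem_powersetCard.1 hS).2
    have h1 := sum_overlap_le hkn hδ0 hδ S hSk
    have h2 : ∑ T ∈ A with 2 ≤ (S ∩ T).card ∧ T ≠ S, p * p ≤
        ∑ T ∈ A with 2 ≤ (S ∩ T).card ∧ T ≠ S,
          (1 / 2 : ℝ) ^ (pairsOf S ∪ pairsOf T).card := by
      refine sum_le_sum fun T hT => ?_
      have hTk := (mem_powersetCard.1 (mem_filter.1 hT).1).2
      rw [hp, ← pow_add]
      refine pow_le_pow_of_le_one (by norm_num) (by norm_num) ?_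
      have := card_pairsOf_union S T
      rw [hSk, hTk] at this
      omega
    have h3 : ∑ T ∈ A with 2 ≤ (S ∩ T).card, p * p ≤
        p * p + ∑ T ∈ A with 2 ≤ (S ∩ T).card ∧ T ≠ S, p * p := by
      have hSmem : S ∉ ({T ∈ A | 2 ≤ (S ∩ T).card ∧ T ≠ S} : Finset _) := by simp
      rw [← sum_insert (f := fun _ => p * p) hSmem]
      refine sum_le_sum_of_subset_of_nonneg ?_ fun _ _ _ => mul_nonneg hp0 hp0
      intro T hT
      simp only [mem_filter, mem_insert] at hT ⊢
      tauto
    have h4 : (∑ ω ∈ E S, (1 / 2 : ℝ) ^ N) *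
      (∑ T ∈ A with 2 ≤ (S ∩ T).card, ∑ ω ∈ E T, (1 / 2 : ℝ) ^ N) =
        ∑ T ∈ A with 2 ≤ (S ∩ T).card, p * p := by
      rw [mul_sum]
      refine sum_congr rfl fun T hT => ?_
      rw [hEA S hS, hEA T (mem_filter.1 hT).1]
    rw [h4, sum_congr rfl fun T _ => hEE S T]
    linarith
  refine (sum_le_sum hterm).trans_eq ?_
  rw [sum_const, nsmul_eq_mul, hA, card_powersetCard, card_univ, Fintype.card_fin]
  have : f n k = n.choose k * p := f_eq n k
  rw [this]
  ring

end Overlap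

lemma pow_le_pow_mul_choose (n k : ℕ) (hkn : k ≤ n) : n ^ k ≤ k ^ k * n.choose k := by
  induction k generalizing n with
  | zero => simp
  | succ k ih =>
    obtain ⟨n, rfl⟩ : ∃ m, n = m + 1 := ⟨n - 1, by omega⟩
    have hk : k ≤ n := by omega
    rcases Nat.eq_zero_or_pos k with rfl | hk0
    · simp
    refine Nat.le_of_mul_le_mul_left ?_ (pow_pos hk0 k)
    calc k ^ k * (n + 1) ^ (k + 1) = (k * (n + 1)) ^ k * (n + 1) := by rw [mul_pow]; ring
      _ ≤ ((k + 1) * n) ^ k * (n + 1) := by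
        gcongr ?_ ^ k * _
        nlinarith
      _ = (k + 1) ^ k * n ^ k * (n + 1) := by rw [mul_pow]
      _ ≤ (k + 1) ^ k * (k ^ k * n.choose k) * (n + 1) := by
        gcongr
        exact ih n hk
      _ = (k + 1) ^ k * k ^ k * ((n + 1) * n.choose k) := by ring
      _ = (k + 1) ^ k * k ^ k * ((n + 1).choose (k + 1) * (k + 1)) := by
        rw [Nat.add_one_mul_choose_eq]
      _ = k ^ k * ((k + 1) ^ (k + 1) * (n + 1).choose (k + 1)) := by ring

lemma choose_le_choose_mul_pow {n k i : ℕ} (hik : i ≤ k) :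
    n.choose k ≤ n.choose i * n ^ (k - i) :=
  calc n.choose k ≤ n.choose k * k.choose i := Nat.le_mul_of_pos_right _ (Nat.choose_pos hik)
    _ = n.choose i * (n - i).choose (k - i) := Nat.choose_mul hik
    _ ≤ n.choose i * n ^ (k - i) := by
      gcongr
      exact (Nat.choose_le_pow _ _).trans (Nat.pow_le_pow_left (Nat.sub_le _ _) _)

lemma choose_two_mul_two (n : ℕ) : n.choose 2 * 2 = n * (n - 1) := by
  rw [Nat.choose_two_right, Nat.div_mul_cancel (Nat.even_mul_pred_self n).two_dvd]

lemma choose_two_add_mul_le {k i : ℕ} (hik : i ≤ k) : i.choose 2 + i * (k - i) ≤ k.choose 2 := by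
  obtain ⟨d, rfl⟩ := Nat.exists_eq_add_of_le hik
  rw [Nat.add_sub_cancel_left]
  clear hik
  induction d with
  | zero => simp
  | succ d ih =>
    rw [← add_assoc, Nat.choose_succ_succ' (i + d) 1, Nat.choose_one_right, mul_add, mul_one]
    simp only [Nat.reduceAdd]
    omega

section Asymptotics

variable {n k : ℕ} {b c : ℝ}

lemma pow_sub_one_le_of_one_le_f (hb : 0 < b) (hb6 : b ^ 6 = 2) (hk : 1 ≤ k) (h1 : 1 ≤ f n k) :
    b ^ (3 * (k - 1)) ≤ n := by
  rw [f_eq, one_div, inv_pow, ← div_eq_mul_inv, le_div_iff₀ (by positivity), one_mul] at h1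
  rw [← pow_le_pow_iff_left₀ (by positivity) (by positivity) (by omega : k ≠ 0)]
  calc (b ^ (3 * (k - 1))) ^ k = (b ^ 6) ^ k.choose 2 := by
        rw [← pow_mul, ← pow_mul]
        congr 1
        have := choose_two_mul_two k
        linarith
    _ ≤ n.choose k := by rwa [hb6]
    _ ≤ (n : ℝ) ^ k := by exact_mod_cast Nat.choose_le_pow n k

lemma le_mul_pow_of_f_le (hb : 1 ≤ b) (hb6 : b ^ 6 = 2) (hk : 1 ≤ k) (hkn : k ≤ n)
    (hc : 1 ≤ c) (h2 : f n k ≤ c) : (n : ℝ) ≤ c * k * b ^ (3 * k) := by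
  have hb0 : 0 < b := by linarith
  rw [f_eq, one_div, inv_pow, ← div_eq_mul_inv, div_le_iff₀ (by positivity)] at h2
  rw [← pow_le_pow_iff_left₀ (by positivity) (by positivity) (by omega : k ≠ 0)]
  calc (n : ℝ) ^ k ≤ k ^ k * n.choose k := by exact_mod_cast pow_le_pow_mul_choose n k hkn
    _ ≤ k ^ k * (c * 2 ^ k.choose 2) := by gcongr
    _ = c * k ^ k * b ^ (3 * (k - 1) * k) := by
      rw [← hb6, ← pow_mul]
      have := choose_two_mul_two k
      rw [show 6 * k.choose 2 = 3 * (k - 1) * k by linarith]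
      ring
    _ ≤ c ^ k * k ^ k * b ^ (3 * k * k) := by
      have := pow_le_pow_right₀ hb (show 3 * (k - 1) * k ≤ 3 * k * k by gcongr; omega)
      have := le_self_pow₀ hc (show k ≠ 0 by omega)
      gcongr
    _ = _ := by ring

lemma choose_sq_div_f_le (hb : 1 ≤ b) (hb6 : b ^ 6 = 2) (hkn : k ≤ n)
    (hc : 1 ≤ c) (h1 : 1 ≤ f n k) (h2 : f n k ≤ c)
    (hsmall : (2 + c) * (k ^ 3 / b ^ k) ≤ 1) :
    ∀ i ∈ Finset.Ico 2 k, (k.choose i : ℝ) ^ 2 / f n i ≤ (2 + c) * (k ^ 3 / b ^ k) := by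
  intro i hi
  rw [Finset.mem_Ico] at hi
  have hb0 : 0 < b := by linarith
  have hn1 := pow_sub_one_le_of_one_le_f hb0 hb6 (by omega) h1
  have hn2 := le_mul_pow_of_f_le hb hb6 (by omega) hkn hc h2
  have hn0 : (0 : ℝ) < n := by
    have : 0 < n := by omega
    exact_mod_cast this
  have hk0 : (0 : ℝ) < k := by
    have : 0 < k := by omega
    exact_mod_cast this
  have hchoose : (0 : ℝ) < n.choose i := by exact_mod_cast Nat.choose_pos (by omega)
  have hb3 : b ^ 3 ≤ 2 := by
    rw [← hb6]
    exact pow_le_pow_right₀ hb (by norm_num)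
  set δ := (2 + c) * (k ^ 3 / b ^ k) with hδ
  have hfi : f n i = n.choose i / 2 ^ i.choose 2 := by
    rw [f_eq, one_div, inv_pow, div_eq_mul_inv]
  rcases le_total (3 * i) (2 * k) with h | h
  · set x : ℝ := k ^ 3 * b ^ (2 * k) / n with hx
    have hx0 : 0 ≤ x := by positivity
    have hxδ : x ≤ δ := by
      calc x ≤ k ^ 3 * b ^ (2 * k) / b ^ (3 * (k - 1)) := by
            rw [hx]
            gcongr
        _ = b ^ 3 * (k ^ 3 / b ^ k) := by
            obtain ⟨j, rfl⟩ : ∃ j, k = j + 1 := ⟨k - 1, by omega⟩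
            simp only [Nat.add_sub_cancel]
            rw [div_eq_iff (by positivity), mul_div_assoc', div_mul_eq_mul_div,
              eq_div_iff (by positivity)]
            ring
        _ ≤ δ := by
            rw [hδ]
            gcongr
            linarith
    have hxi : (k.choose i : ℝ) ^ 2 / f n i ≤ x ^ i := by
      have e1 : (k.choose i : ℝ) ≤ k ^ i := by exact_mod_cast Nat.choose_le_pow k i
      have e2 : (n : ℝ) ^ i ≤ k ^ i * n.choose i := by
        calc (n : ℝ) ^ i ≤ i ^ i * n.choose i := by
              exact_mod_cast pow_le_pow_mul_choose n i (by omega)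
          _ ≤ _ := by
              gcongr
              exact hi.2.le
      have e3 : (2 : ℝ) ^ i.choose 2 ≤ b ^ (2 * k * i) := by
        rw [← hb6, ← pow_mul]
        refine pow_le_pow_right₀ hb ?_
        have := choose_two_mul_two i
        calc 6 * i.choose 2 = 3 * (i - 1) * i := by linarith
          _ ≤ 2 * k * i := Nat.mul_le_mul_right _ (by omega)
      rw [hfi, div_div_eq_mul_div, div_le_iff₀ hchoose, hx, div_pow, div_mul_eq_mul_div,
        le_div_iff₀ (by positivity)]
      calc (k.choose i : ℝ) ^ 2 * 2 ^ i.choose 2 * n ^ i ≤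
          (k ^ i) ^ 2 * b ^ (2 * k * i) * (k ^ i * n.choose i) := by gcongr
        _ = _ := by
          rw [mul_pow]
          ring
    exact hxi.trans ((pow_le_of_le_one hx0 (hxδ.trans hsmall) (by omega)).trans hxδ)
  · set y : ℝ := k ^ 2 * n / b ^ (4 * k) with hy
    have hy0 : 0 ≤ y := by positivity
    have hyδ : y ≤ δ := by
      calc y ≤ k ^ 2 * (c * k * b ^ (3 * k)) / b ^ (4 * k) := by
            rw [hy]
            gcongr
        _ = c * (k ^ 3 / b ^ k) := by
            rw [div_eq_iff (by positivity), mul_div_assoc', div_mul_eq_mul_div,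
              eq_div_iff (by positivity)]
            ring
        _ ≤ δ := by
            rw [hδ]
            gcongr
            linarith
    have hyi : (k.choose i : ℝ) ^ 2 / f n i ≤ y ^ (k - i) := by
      have e1 : (k.choose i : ℝ) ≤ k ^ (k - i) := by
        rw [← Nat.choose_symm hi.2.le]
        exact_mod_cast Nat.choose_le_pow k (k - i)
      have e2 : (n.choose k : ℝ) ≤ n.choose i * n ^ (k - i) := by
        exact_mod_cast choose_le_choose_mul_pow hi.2.le
      have e3 : (2 : ℝ) ^ i.choose 2 * b ^ (4 * k * (k - i)) ≤ 2 ^ k.choose 2 := by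
        calc (2 : ℝ) ^ i.choose 2 * b ^ (4 * k * (k - i)) ≤
            2 ^ i.choose 2 * b ^ (6 * (i * (k - i))) := by
              refine mul_le_mul_of_nonneg_left (pow_le_pow_right₀ hb ?_) (by positivity)
              rw [← mul_assoc]
              exact Nat.mul_le_mul_right _ (by omega)
          _ = 2 ^ (i.choose 2 + i * (k - i)) := by rw [pow_mul, hb6, pow_add]
          _ ≤ 2 ^ k.choose 2 := pow_le_pow_right₀ (by norm_num) (choose_two_add_mul_le hi.2.le)
      rw [f_eq, one_div, inv_pow, ← div_eq_mul_inv, le_div_iff₀ (by positivity), one_mul] at h1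
      rw [hfi, div_div_eq_mul_div, div_le_iff₀ hchoose, hy, div_pow, div_mul_eq_mul_div,
        le_div_iff₀ (by positivity)]
      calc (k.choose i : ℝ) ^ 2 * 2 ^ i.choose 2 * (b ^ (4 * k)) ^ (k - i)
        = (k.choose i : ℝ) ^ 2 * (2 ^ i.choose 2 * b ^ (4 * k * (k - i))) := by
            rw [← pow_mul]
            ring
        _ ≤ ((k : ℝ) ^ (k - i)) ^ 2 * (n.choose i * n ^ (k - i)) := by
          have := e3.trans (h1.trans e2)
          exact mul_le_mul (by gcongr) this (by positivity) (by positivity)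
        _ = _ := by
          rw [mul_pow]
          ring
    exact hyi.trans ((pow_le_of_le_one hy0 (hyδ.trans hsmall) (by omega)).trans hyδ)

end Asymptotics

lemma k0_spec {n : ℕ} (hn : 1 ≤ n) : 1 ≤ k0 n ∧ k0 n ≤ n ∧ 1 ≤ f n (k0 n) := by
  have hle : ∀ k, 1 ≤ f n k → k ≤ n := by
    intro k hk
    by_contra h
    rw [f_eq, Nat.choose_eq_zero_of_lt (by omega)] at hk
    norm_num at hk
  have hbdd : BddAbove {k | 1 ≤ f n k} := ⟨n, fun k hk => hle k hk⟩
  have hmem : 1 ∈ {k | 1 ≤ f n k} := by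
    have : 1 ≤ f n 1 := by simpa [f_eq] using hn
    exact this
  have h0 : 1 ≤ f n (k0 n) := Nat.sSup_mem ⟨1, hmem⟩ hbdd
  exact ⟨le_csSup hbdd hmem, hle _ h0, h0⟩

/-- along a sequence with `c1 ≤ f(k₀) ≤ c2` and `λ = f(k₀)`, the number `X`
of independent sets of size `k₀` in `G(n,1/2)` satisfies `|P(X = 0) - e^{-λ}| → 0`. -/
theorem poisson_approx_indep
    (c1 c2 : ℝ) (hc1 : 0 < c1) (hc12 : c1 ≤ c2)
    (s : ℕ → ℕ) (hs : StrictMono s)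
    (hf : ∀ j, c1 ≤ f (s j) (k0 (s j)) ∧ f (s j) (k0 (s j)) ≤ c2) :
    Tendsto (fun j =>
      |(erdosRenyi (s j) (1/2) {ω | numIndep (s j) (k0 (s j)) ω = 0}).toReal -
        Real.exp (-(f (s j) (k0 (s j))))|) atTop (nhds 0) := by
  obtain ⟨b, hb, hb6⟩ : ∃ b : ℝ, 1 < b ∧ b ^ 6 = 2 := by
    refine ⟨2 ^ (1 / 6 : ℝ), Real.one_lt_rpow (by norm_num) (by norm_num), ?_⟩
    rw [← Real.rpow_natCast, ← Real.rpow_mul (by norm_num)]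
    norm_num
  set k : ℕ → ℕ := fun j => k0 (s j)
  have hspec : ∀ᶠ j in atTop, 1 ≤ k j ∧ k j ≤ s j ∧ 1 ≤ f (s j) (k j) := by
    filter_upwards [hs.tendsto_atTop.eventually_ge_atTop 1] with j hj using k0_spec hj
  have hc : 1 ≤ c2 := by
    obtain ⟨j, hj⟩ := hspec.exists
    exact hj.2.2.trans (hf j).2
  have hk : Tendsto k atTop atTop := by
    refine tendsto_atTop.2 fun K => ?_
    have hbig : ∀ᶠ j in atTop, c2 * K * b ^ (3 * K) < (s j : ℝ) :=
      (tendsto_natCast_atTop_atTop.comp hs.tendsto_atTop).eventually_gt_atTop _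
    filter_upwards [hbig, hspec] with j hj hj'
    by_contra! h
    have := le_mul_pow_of_f_le hb.le hb6 hj'.1 hj'.2.1 hc (hf j).2
    have h2 : c2 * k j * b ^ (3 * k j) ≤ c2 * K * b ^ (3 * K) := by
      have := hb.le
      gcongr
    linarith
  have hlim3 : Tendsto (fun j => (2 + c2) * ((k j : ℝ) ^ 3 / b ^ k j)) atTop (nhds 0) := by
    simpa using ((tendsto_pow_const_div_const_pow_of_one_lt 3 hb).comp hk).const_mul (2 + c2)
  have hlim : Tendsto (fun j => c2 * (2 * (1 / 2 : ℝ) ^ k j) +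
      2 * (c2 ^ 2 * ((2 + c2) * ((k j : ℝ) ^ 4 / b ^ k j)))) atTop (nhds 0) := by
    have h4 := (tendsto_pow_const_div_const_pow_of_one_lt 4 hb).comp hk
    have h5 := (tendsto_pow_atTop_nhds_zero_of_lt_one (r := (1 / 2 : ℝ)) (by norm_num)
      (by norm_num)).comp hk
    simpa using ((h5.const_mul 2).const_mul c2).add
      (((h4.const_mul (2 + c2)).const_mul (c2 ^ 2)).const_mul 2)
  refine squeeze_zero' (Eventually.of_forall fun _ => abs_nonneg _) ?_ hlim
  filter_upwards [hspec, hk.eventually_ge_atTop 2, hlim3.eventually_le_const one_pos]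
    with j hj hk2 hsmall
  have hb0 : 0 < b := by linarith
  have hδ := choose_sq_div_f_le hb.le hb6 hj.2.1 hc hj.2.2 (hf j).2 hsmall
  have hfc : f (s j) (k j) ≤ c2 := (hf j).2
  have hf0 := f_nonneg (s j) (k j)
  refine (abs_void_indep_sub_exp_le hj.2.1 hk2 (by positivity) hδ).trans ?_
  have hpow : (1 / 2 : ℝ) ^ (k j).choose 2 ≤ 2 * (1 / 2 : ℝ) ^ k j := by
    have h1 := choose_two_add_mul_le hj.1
    calc (1 / 2 : ℝ) ^ (k j).choose 2 ≤ (1 / 2 : ℝ) ^ (k j - 1) :=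
          pow_le_pow_of_le_one (by norm_num) (by norm_num) (by omega)
      _ = 2 * (1 / 2 : ℝ) ^ (k j - 1 + 1) := by rw [pow_succ]; ring
      _ = 2 * (1 / 2 : ℝ) ^ k j := by rw [Nat.sub_add_cancel hj.1]
  have hmul : (k j : ℝ) * ((2 + c2) * ((k j : ℝ) ^ 3 / b ^ k j)) =
      (2 + c2) * ((k j : ℝ) ^ 4 / b ^ k j) := by ring
  rw [hmul]
  gcongr

end RandomBipartiteDecomposition
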